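/- Let v be an additive order function on R′, let u, w ∈ R′, and let A be an n×n matrix over R′ with A·A = −w·1 (so that (u·1+A)·(u·1−A) = (u²+w)·1). Let a, d, d′ ∈ ℤ and α, β : Fin n → ℤ satisfy v(u) ≥ a, v(w) ≥ d, d′ ≤ d, d′ ≤ 2a, and, for all i, j, v(A_{ij}) ≥ β_i − α_j and v(A_{ij}) ≥ α_i + d − β_j. Then for every k ∈ ℤ with d′ − d − a ≤ k ≤ a − d′ (and such k exists, since d′ − d − a ≤ a − d′): matrix–vector multiplication by u·1 + A maps the submodule P_{(min(α_i, β_i+k))_i} of R′ⁿ into P_{(min(β_i + min(0, a+k), α_i + min(a, d+k)))_i}, and multiplication by u·1 − A maps P_{(min(β_i + min(0, a+k), α_i + min(a, d+k)))_i} into P_{(min(α_i, β_i+k) + d′)_i}; that is, the factorization (u·1+A, u·1−A) of u² + w is again asymptotically periodic with shift d′. -/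

import Mathlib

lemma coe_le_map_mul_of_le {R : Type*} [Mul R] {v : R → WithTop ℤ}
    (hvmul : ∀ x y : R, v (x * y) = v x + v y) {p q r : ℤ} {x y : R}
    (hx : (p : WithTop ℤ) ≤ v x) (hy : (q : WithTop ℤ) ≤ v y) (hr : r ≤ p + q) :
    (r : WithTop ℤ) ≤ v (x * y) := by
  rw [hvmul]
  exact (WithTop.coe_le_coe.2 hr).trans (by rw [WithTop.coe_add]; exact add_le_add hx hy)

lemma le_map_sum_of_forall_le {R ι Γ : Type*} [AddCommMonoid R] [LinearOrder Γ] {v : R → Γ}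
    (hvadd : ∀ x y : R, min (v x) (v y) ≤ v (x + y)) {s : Finset ι} (hs : s.Nonempty)
    {f : ι → R} {c : Γ} (h : ∀ i ∈ s, c ≤ v (f i)) : c ≤ v (∑ i ∈ s, f i) :=
  Finset.sum_induction_nonempty f (fun x => c ≤ v x)
    (fun x y hx hy => (le_min hx hy).trans (hvadd x y)) hs h

/-- A lower bound for the value of each coordinate of `(u·1 + A) x`, from termwise bounds. -/
lemma le_map_smul_one_add_mulVec {R : Type*} [CommRing R] {v : R → WithTop ℤ}
    (hvadd : ∀ x y : R, min (v x) (v y) ≤ v (x + y)) {n : ℕ} {u : R}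
    {A : Matrix (Fin n) (Fin n) R} {x : Fin n → R} {i : Fin n} {c : WithTop ℤ}
    (hu : c ≤ v (u * x i)) (hA : ∀ j, c ≤ v (A i j * x j)) :
    c ≤ v ((u • (1 : Matrix (Fin n) (Fin n) R) + A).mulVec x i) := by
  have h : (u • (1 : Matrix (Fin n) (Fin n) R) + A).mulVec x i
      = u * x i + ∑ j, A i j * x j := by
    simp only [Matrix.add_mulVec, Matrix.smul_mulVec, Matrix.one_mulVec, Pi.add_apply,
      Pi.smul_apply, smul_eq_mul]
    rfl
  rw [h]
  exact (le_min hu (le_map_sum_of_forall_le hvadd ⟨i, Finset.mem_univ i⟩ fun j _ => hA j)).trans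
    (hvadd _ _)

/-- the factorization `(u·1 + A, u·1 − A)` of `u² + w` is again
asymptotically periodic with shift `d′`, for suitable `k`. -/
theorem statement12 {R' : Type*} [CommRing R'] (v : R' → WithTop ℤ)
    (hv1 : v 1 = 0)
    (hvmul : ∀ x y : R', v (x * y) = v x + v y)
    (hvadd : ∀ x y : R', min (v x) (v y) ≤ v (x + y))
    (hvnonneg : ∀ x : R', 0 ≤ v x)
    {n : ℕ} (u w : R') (A : Matrix (Fin n) (Fin n) R')
    (hA2 : A * A = -(w • (1 : Matrix (Fin n) (Fin n) R')))
    (a d d' : ℤ) (α β : Fin n → ℤ)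
    (hu : (a : WithTop ℤ) ≤ v u) (hw : (d : WithTop ℤ) ≤ v w)
    (hd'd : d' ≤ d) (hd'a : d' ≤ 2 * a)
    (hA₁ : ∀ i j, ((β i - α j : ℤ) : WithTop ℤ) ≤ v (A i j))
    (hA₂ : ∀ i j, ((α i + d - β j : ℤ) : WithTop ℤ) ≤ v (A i j)) :
    (d' - d - a ≤ a - d') ∧
    ∀ k : ℤ, d' - d - a ≤ k → k ≤ a - d' →
      (∀ x : Fin n → R',
        (∀ i, ((min (α i) (β i + k) : ℤ) : WithTop ℤ) ≤ v (x i)) →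
        ∀ i, ((min (β i + min 0 (a + k)) (α i + min a (d + k)) : ℤ) : WithTop ℤ)
          ≤ v ((u • (1 : Matrix (Fin n) (Fin n) R') + A).mulVec x i)) ∧
      (∀ y : Fin n → R',
        (∀ i, ((min (β i + min 0 (a + k)) (α i + min a (d + k)) : ℤ) : WithTop ℤ)
          ≤ v (y i)) →
        ∀ i, ((min (α i) (β i + k) + d' : ℤ) : WithTop ℤ)
          ≤ v ((u • (1 : Matrix (Fin n) (Fin n) R') - A).mulVec y i)) := by
  have hneg : ∀ x, v x ≤ v (-x) := fun x => by
    rw [← neg_one_mul, hvmul]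
    exact le_add_of_nonneg_left (hvnonneg _)
  refine ⟨by omega, fun k hk₁ hk₂ => ⟨fun x hx i => ?_, fun y hy i => ?_⟩⟩
  · refine le_map_smul_one_add_mulVec hvadd
      (coe_le_map_mul_of_le hvmul hu (hx i) (by omega)) fun j => ?_
    rcases le_total (α j) (β j + k) with h | h
    · exact coe_le_map_mul_of_le hvmul (hA₁ i j) (hx j) (by omega)
    · exact coe_le_map_mul_of_le hvmul (hA₂ i j) (hx j) (by omega)
  · rw [sub_eq_add_neg]
    refine le_map_smul_one_add_mulVec hvadd
      (coe_le_map_mul_of_le hvmul hu (hy i) (by omega)) fun j => ?_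
    rw [Matrix.neg_apply]
    rcases le_total (β j + min 0 (a + k)) (α j + min a (d + k)) with h | h
    · exact coe_le_map_mul_of_le hvmul ((hA₂ i j).trans (hneg _)) (hy j) (by omega)
    · exact coe_le_map_mul_of_le hvmul ((hA₁ i j).trans (hneg _)) (hy j) (by omega)
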